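/- arXiv:1408.6574 — 2 statements merged into one kernel-verified Lean document; each statement's English description precedes it below -/
import Mathlib

section
/- Let w : T² → ℝ be smooth with ∫_{T²} w dx = 0, and suppose Δw = g where ‖g‖_{L¹(T²)} ≤ M. Then for every q ∈ (1,2) there exists C_q = C_q(M, T², q) such that ‖∇w‖_{L^q(T²)} ≤ C_q. -/
open Real Filter MeasureTheory

noncomputable def lap2 (u : EuclideanSpace ℝ (Fin 2) → ℝ) (x : EuclideanSpace ℝ (Fin 2)) : ℝ :=
  ∑ i : Fin 2, fderiv ℝ (fun y => fderiv ℝ u y (EuclideanSpace.single i (1:ℝ))) x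
    (EuclideanSpace.single i (1:ℝ))

/-- Fundamental domain of the unit flat torus `ℝ²/ℤ²`. -/
def fundDom : Set (EuclideanSpace ℝ (Fin 2)) := {x | ∀ i, x i ∈ Set.Ico (0:ℝ) 1}

section helpers
open Set Interval
abbrev E2 := EuclideanSpace ℝ (Fin 2)

abbrev pt (a b : ℝ) : E2 := !₂[a,b]
noncomputable abbrev nu : Measure ℝ := volume.restrict (Ioc (0:ℝ) 1)

lemma continuous_pt : Continuous (fun z : ℝ × ℝ => pt z.1 z.2) := by
  unfold pt; fun_prop

lemma map_fund (F : E2 → ℝ) : ∫ x in fundDom, F x = ∫ z, F (pt z.1 z.2) ∂(nu.prod nu) := by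
  have h1 := (EuclideanSpace.volume_preserving_symm_measurableEquiv_toLp (Fin 2))
  have h2 := (volume_preserving_finTwoArrow ℝ)
  have h3 := (h2.comp h1).symm ((MeasurableEquiv.toLp 2 (Fin 2 → ℝ)).symm.trans MeasurableEquiv.finTwoArrow)
  have h4 := h3.setIntegral_preimage_emb (MeasurableEquiv.measurableEmbedding _) F fundDom
  rw [← h4]
  have h5 : (((MeasurableEquiv.toLp 2 (Fin 2 → ℝ)).symm.trans MeasurableEquiv.finTwoArrow).symm ⁻¹' fundDom) = Ico (0:ℝ) 1 ×ˢ Ico (0:ℝ) 1 := by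
    ext z
    simp [fundDom, Fin.forall_fin_two]
  rw [h5, nu, Measure.restrict_congr_set (Ico_ae_eq_Ioc (a := (0:ℝ)) (b := 1) (μ := volume)).symm, Measure.prod_restrict]
  rfl

instance : IsProbabilityMeasure nu := ⟨by simp [nu]⟩

lemma int_cont2 {F : ℝ × ℝ → ℝ} (hF : Continuous F) : Integrable F (nu.prod nu) := by
  rw [nu, Measure.prod_restrict]
  have : IntegrableOn F (Icc (0:ℝ) 1 ×ˢ Icc (0:ℝ) 1) (volume.prod volume) :=
    hF.continuousOn.integrableOn_compact (isCompact_Icc.prod isCompact_Icc)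
  exact this.mono_set (prod_mono Ioc_subset_Icc_self Ioc_subset_Icc_self)

lemma int_cont1 {F : ℝ → ℝ} (hF : Continuous F) : Integrable F nu :=
  (hF.continuousOn.integrableOn_compact isCompact_Icc).mono_set (Ioc_subset_Icc_self (a := (0:ℝ)) (b := 1))

lemma cont_param {F : ℝ × ℝ → ℝ} (hF : Continuous F) : Continuous (fun a => ∫ b, F (a, b) ∂nu) := by
  have h := intervalIntegral.continuous_parametric_intervalIntegral_of_continuous' (μ := volume) (f := fun a b => F (a,b)) hF 0 1
  simpa [intervalIntegral.integral_of_le] using h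

lemma osc1 {u u' d : ℝ → ℝ} (hu : ∀ t, HasDerivAt u (u' t) t) (hu' : Continuous u') (hd : Continuous d)
    (h : ∀ t, |u' t| ≤ d t) {a s : ℝ} (ha : a ∈ Icc (0:ℝ) 1) (hs : s ∈ Icc (0:ℝ) 1) :
    |u a - u s| ≤ ∫ t, d t ∂nu := by
  rw [← intervalIntegral.integral_eq_sub_of_hasDerivAt (fun t _ => hu t) (hu'.intervalIntegrable _ _)]
  refine (intervalIntegral.norm_integral_le_integral_norm_uIoc (f := u') ).trans ?_
  have h0 : ∀ t, 0 ≤ d t := fun t => (abs_nonneg _).trans (h t)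
  calc ∫ t in Ι s a, ‖u' t‖ ≤ ∫ t in Ι s a, d t := by
        refine setIntegral_mono ?_ ?_ h
        · exact (hu'.norm.intervalIntegrable _ _).def'
        · exact (hd.intervalIntegrable _ _).def'
    _ ≤ _ := by
        refine setIntegral_mono_set (int_cont1 hd) (.of_forall h0) (LE.le.eventuallyLE ?_)
        intro t ht
        rw [mem_uIoc] at ht
        constructor <;> rcases ht with h | h <;> linarith [h.1,h.2,ha.1,ha.2,hs.1,hs.2]

lemma ae_nu : ∀ᵐ t ∂nu, t ∈ Icc (0:ℝ) 1 := by
  filter_upwards [ae_restrict_mem measurableSet_Ioc] with t ht using Ioc_subset_Icc_self ht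

lemma ae_nu2 : ∀ᵐ z ∂(nu.prod nu), z.1 ∈ Icc (0:ℝ) 1 ∧ z.2 ∈ Icc (0:ℝ) 1 := by
  rw [nu, Measure.prod_restrict]
  filter_upwards [ae_restrict_mem (measurableSet_Ioc.prod measurableSet_Ioc)] with z hz using
   ⟨Ioc_subset_Icc_self hz.1, Ioc_subset_Icc_self hz.2⟩

lemma line1 {f : E2 → ℝ} (hf : ContDiff ℝ 1 f) (b t : ℝ) :
    HasDerivAt (fun a => f (pt a b)) (fderiv ℝ f (pt t b) (EuclideanSpace.single 0 1)) t := by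
  have h1 : HasDerivAt (fun a => pt a b) (EuclideanSpace.single 0 (1:ℝ)) t := by
    have : (fun a => pt a b) = fun a => pt 0 b + a • (EuclideanSpace.single 0 (1:ℝ) : E2) := by
      ext a i; fin_cases i <;> simp
    rw [this]
    simpa using ((hasDerivAt_id t).smul_const (EuclideanSpace.single 0 (1:ℝ) : E2)).const_add (pt 0 b)
  exact ((hf.differentiable (by norm_num)) _).hasFDerivAt.comp_hasDerivAt t h1

lemma line2 {f : E2 → ℝ} (hf : ContDiff ℝ 1 f) (a t : ℝ) :
    HasDerivAt (fun b => f (pt a b)) (fderiv ℝ f (pt a t) (EuclideanSpace.single 1 1)) t := by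
  have h1 : HasDerivAt (fun b => pt a b) (EuclideanSpace.single 1 (1:ℝ)) t := by
    have : (fun b => pt a b) = fun b => pt a 0 + b • (EuclideanSpace.single 1 (1:ℝ) : E2) := by
      ext a i; fin_cases i <;> simp
    rw [this]
    simpa using ((hasDerivAt_id t).smul_const (EuclideanSpace.single 1 (1:ℝ) : E2)).const_add (pt a 0)
  exact ((hf.differentiable (by norm_num)) _).hasFDerivAt.comp_hasDerivAt t h1

lemma fd_le (L : E2 →L[ℝ] ℝ) (i : Fin 2) : |L (EuclideanSpace.single i 1)| ≤ ‖L‖ := by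
  simpa using L.le_opNorm (EuclideanSpace.single i 1)

lemma cont_fd {f : E2 → ℝ} (hf : ContDiff ℝ 1 f) : Continuous (fderiv ℝ f) :=
  hf.continuous_fderiv (by norm_num)

lemma osc_a {f : E2 → ℝ} (hf : ContDiff ℝ 1 f) {a a' : ℝ} (b : ℝ) (ha : a ∈ Icc (0:ℝ) 1) (ha' : a' ∈ Icc (0:ℝ) 1) :
    |f (pt a b) - f (pt a' b)| ≤ ∫ t, ‖fderiv ℝ f (pt t b)‖ ∂nu := by
  have hc := cont_fd hf
  have hp : Continuous (fun t => pt t b) := continuous_pt.comp (by fun_prop : Continuous fun t : ℝ => (t, b))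
  exact osc1 (fun t => line1 hf b t) ((hc.comp hp).clm_apply continuous_const) (hc.comp hp).norm (fun t => fd_le _ _) ha ha'

lemma osc_b {f : E2 → ℝ} (hf : ContDiff ℝ 1 f) {b b' : ℝ} (a : ℝ) (ha : b ∈ Icc (0:ℝ) 1) (ha' : b' ∈ Icc (0:ℝ) 1) :
    |f (pt a b) - f (pt a b')| ≤ ∫ t, ‖fderiv ℝ f (pt a t)‖ ∂nu := by
  have hc := cont_fd hf
  have hp : Continuous (fun t => pt a t) := continuous_pt.comp (by fun_prop : Continuous fun t : ℝ => (a, t))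
  exact osc1 (fun t => line2 hf a t) ((hc.comp hp).clm_apply continuous_const) (hc.comp hp).norm (fun t => fd_le _ _) ha ha'

lemma int_fund {F : E2 → ℝ} (hF : Continuous F) : IntegrableOn F fundDom := by
  have hb : Bornology.IsBounded fundDom := by
    refine (Metric.isBounded_iff_subset_closedBall 0).2 ⟨2, fun x hx => ?_⟩
    have h0 := hx 0
    have h1 := hx 1
    rw [mem_closedBall_zero_iff, EuclideanSpace.norm_eq, Real.sqrt_le_left (by norm_num)]
    simp only [Fin.sum_univ_two, Real.norm_eq_abs, sq_abs]
    nlinarith [h0.1, h0.2, h1.1, h1.2]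
  exact (hF.continuousOn.integrableOn_compact hb.isCompact_closure).mono_set subset_closure

lemma sobolev {f : E2 → ℝ} (hf : ContDiff ℝ 1 f) :
    ∫ x in fundDom, f x ^ 2 ≤ ((∫ x in fundDom, |f x|) + ∫ x in fundDom, ‖fderiv ℝ f x‖) ^ 2 := by
  have hc := cont_fd hf
  have hf0 := hf.continuous
  have hcp := continuous_pt
  set H : E2 → ℝ := fun x => |f x| + ‖fderiv ℝ f x‖ with hH
  have hHc : Continuous H := hf0.abs.add hc.norm
  have hHp : Continuous (fun z : ℝ × ℝ => H (pt z.1 z.2)) := hHc.comp hcp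
  have hHp' : Continuous (fun z : ℝ × ℝ => H (pt z.2 z.1)) := hHp.comp continuous_swap
  set A : ℝ → ℝ := fun b => ∫ s, H (pt s b) ∂nu
  set B : ℝ → ℝ := fun a => ∫ t, H (pt a t) ∂nu
  have hA : Continuous A := cont_param (F := fun z => H (pt z.2 z.1)) hHp'
  have hB : Continuous B := cont_param (F := fun z => H (pt z.1 z.2)) hHp
  rw [← integral_add (int_fund hf0.abs) (int_fund hc.norm)]
  rw [map_fund, map_fund]
  have e1 : ∫ z, H (pt z.1 z.2) ∂(nu.prod nu) = ∫ b, A b ∂nu := integral_prod_symm _ (int_cont2 hHp)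
  have e2 : ∫ z, H (pt z.1 z.2) ∂(nu.prod nu) = ∫ a, B a ∂nu := integral_prod _ (int_cont2 hHp)
  change _ ≤ (∫ z, H (pt z.1 z.2) ∂(nu.prod nu)) ^ 2
  rw [sq]
  nth_rewrite 1 [e2]
  rw [e1, ← integral_prod_mul]
  refine integral_mono_ae (int_cont2 ((hf0.comp hcp).pow 2)) (int_cont2 ((hB.comp continuous_fst).mul (hA.comp continuous_snd))) ?_
  filter_upwards [ae_nu2] with z hz
  have k1 : |f (pt z.1 z.2)| ≤ A z.2 := by
    have hq : Continuous (fun t => pt t z.2) := hcp.comp (by fun_prop : Continuous fun t : ℝ => (t, z.2))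
    have : A z.2 = (∫ s, |f (pt s z.2)| ∂nu) + ∫ s, ‖fderiv ℝ f (pt s z.2)‖ ∂nu :=
      integral_add (int_cont1 (hf0.comp hq).abs) (int_cont1 (hc.comp hq).norm)
    rw [this]
    have : ∫ s, (|f (pt z.1 z.2)| - ∫ s, ‖fderiv ℝ f (pt s z.2)‖ ∂nu) ∂nu ≤ ∫ s, |f (pt s z.2)| ∂nu := by
      refine integral_mono_ae (integrable_const _) (int_cont1 (hf0.comp hq).abs) ?_
      filter_upwards [ae_nu] with s hs
      have := osc_a hf z.2 hz.1 hs
      have := abs_sub_abs_le_abs_sub (f (pt z.1 z.2)) (f (pt s z.2))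
      linarith
    simp only [integral_const, probReal_univ, one_smul] at this
    linarith
  have k2 : |f (pt z.1 z.2)| ≤ B z.1 := by
    have hq : Continuous (fun t => pt z.1 t) := hcp.comp (by fun_prop : Continuous fun t : ℝ => (z.1, t))
    have : B z.1 = (∫ s, |f (pt z.1 s)| ∂nu) + ∫ s, ‖fderiv ℝ f (pt z.1 s)‖ ∂nu :=
      integral_add (int_cont1 (hf0.comp hq).abs) (int_cont1 (hc.comp hq).norm)
    rw [this]
    have : ∫ s, (|f (pt z.1 z.2)| - ∫ s, ‖fderiv ℝ f (pt z.1 s)‖ ∂nu) ∂nu ≤ ∫ s, |f (pt z.1 s)| ∂nu := by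
      refine integral_mono_ae (integrable_const _) (int_cont1 (hf0.comp hq).abs) ?_
      filter_upwards [ae_nu] with s hs
      have := osc_b hf z.1 hz.2 hs
      have := abs_sub_abs_le_abs_sub (f (pt z.1 z.2)) (f (pt z.1 s))
      linarith
    simp only [integral_const, probReal_univ, one_smul] at this
    linarith
  calc f (pt z.1 z.2) ^ 2 = |f (pt z.1 z.2)| * |f (pt z.1 z.2)| := by rw [← sq, sq_abs]
    _ ≤ B z.1 * A z.2 := mul_le_mul k2 k1 (abs_nonneg _) ((abs_nonneg _).trans k2)

lemma poincare {f : E2 → ℝ} (hf : ContDiff ℝ 1 f) (h0 : ∫ x in fundDom, f x = 0) :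
    ∫ x in fundDom, |f x| ≤ 2 * ∫ x in fundDom, ‖fderiv ℝ f x‖ := by
  have hc := cont_fd hf
  have hf0 := hf.continuous
  have hcp := continuous_pt
  set H : E2 → ℝ := fun x => ‖fderiv ℝ f x‖ with hH
  have hHc : Continuous H := hc.norm
  have hHp : Continuous (fun z : ℝ × ℝ => H (pt z.1 z.2)) := hHc.comp hcp
  have hHp' : Continuous (fun z : ℝ × ℝ => H (pt z.2 z.1)) := hHp.comp continuous_swap
  set A : ℝ → ℝ := fun b => ∫ s, H (pt s b) ∂nu
  set B : ℝ → ℝ := fun a => ∫ t, H (pt a t) ∂nu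
  have hA : Continuous A := cont_param (F := fun z => H (pt z.2 z.1)) hHp'
  have hB : Continuous B := cont_param (F := fun z => H (pt z.1 z.2)) hHp
  rw [map_fund] at h0
  rw [map_fund, map_fund]
  have e1 : ∫ z, H (pt z.1 z.2) ∂(nu.prod nu) = ∫ b, A b ∂nu := integral_prod_symm _ (int_cont2 hHp)
  have e2 : ∫ z, H (pt z.1 z.2) ∂(nu.prod nu) = ∫ a, B a ∂nu := integral_prod _ (int_cont2 hHp)
  set J := ∫ z, H (pt z.1 z.2) ∂(nu.prod nu) with hJ
  have e3 : ∫ z, A z.2 ∂(nu.prod nu) = J := by rw [e1, integral_fun_snd]; simp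
  have e4 : ∫ z, B z.1 ∂(nu.prod nu) = J := by rw [e2, integral_fun_fst]; simp
  have iA : Integrable (fun z : ℝ × ℝ => A z.2) (nu.prod nu) := int_cont2 (hA.comp continuous_snd)
  have iB : Integrable (fun z : ℝ × ℝ => B z.1) (nu.prod nu) := int_cont2 (hB.comp continuous_fst)
  have iF : Integrable (fun z : ℝ × ℝ => f (pt z.1 z.2)) (nu.prod nu) := int_cont2 (hf0.comp hcp)
  have key : ∀ᵐ z ∂(nu.prod nu), |f (pt z.1 z.2)| ≤ A z.2 + J := by
    filter_upwards [ae_nu2] with z hz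
    have : f (pt z.1 z.2) = ∫ y, (f (pt z.1 z.2) - f (pt y.1 y.2)) ∂(nu.prod nu) := by
      rw [integral_sub (integrable_const _) iF, h0]; simp
    rw [this]
    refine (norm_integral_le_integral_norm (_ : ℝ × ℝ → ℝ)).trans ?_
    have : A z.2 + J = ∫ y, (A z.2 + B y.1) ∂(nu.prod nu) := by
      rw [integral_add (integrable_const _) iB, e4]; simp
    rw [this]
    refine integral_mono_ae ((integrable_const _).sub iF).norm ((integrable_const _).add iB) ?_
    filter_upwards [ae_nu2] with y hy
    have a1 := osc_a hf z.2 hz.1 hy.1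
    have a2 := osc_b hf y.1 hz.2 hy.2
    exact (abs_sub_le _ (f (pt y.1 z.2)) _).trans (add_le_add a1 a2)
  refine (integral_mono_ae iF.abs (iA.add (integrable_const J)) key).trans ?_
  have : ∫ z, (A z.2 + J) ∂(nu.prod nu) = J + J := by
    rw [integral_add iA (integrable_const _)]
    rw [e3]; simp
  exact (this.trans (two_mul J).symm).le

lemma ibp {F : E2 → ℝ} (hF : ContDiff ℝ 1 F)
    (hp : ∀ x i, F (x + EuclideanSpace.single i (1:ℝ)) = F x) (i : Fin 2) :
    ∫ x in fundDom, fderiv ℝ F x (EuclideanSpace.single i 1) = 0 := by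
  have hc : ∀ i : Fin 2, Continuous fun x => fderiv ℝ F x (EuclideanSpace.single i 1) := fun i => (cont_fd hF).clm_apply continuous_const
  have hcp := continuous_pt
  rw [map_fund]
  fin_cases i
  · refine (integral_prod_symm _ (int_cont2 ((hc 0).comp hcp))).trans ?_
    refine integral_eq_zero_of_ae (.of_forall fun b => ?_)
    have hq : Continuous (fun t => pt t b) := hcp.comp (by fun_prop : Continuous fun t : ℝ => (t, b))
    have := intervalIntegral.integral_eq_sub_of_hasDerivAt (a := 0) (b := 1) (fun t _ => line1 hF b t) (((hc 0).comp hq).intervalIntegrable _ _)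
    rw [intervalIntegral.integral_of_le zero_le_one] at this
    refine this.trans (sub_eq_zero.2 ?_)
    rw [← hp (pt 0 b) 0]
    congr 1
    ext i; fin_cases i <;> simp
  · refine (integral_prod _ (int_cont2 ((hc 1).comp hcp))).trans ?_
    refine integral_eq_zero_of_ae (.of_forall fun b => ?_)
    have hq : Continuous (fun t => pt b t) := hcp.comp (by fun_prop : Continuous fun t : ℝ => (b, t))
    have := intervalIntegral.integral_eq_sub_of_hasDerivAt (a := 0) (b := 1) (fun t _ => line2 hF b t) (((hc 1).comp hq).intervalIntegrable _ _)
    rw [intervalIntegral.integral_of_le zero_le_one] at this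
    refine this.trans (sub_eq_zero.2 ?_)
    rw [← hp (pt b 0) 1]
    congr 1
    ext i; fin_cases i <;> simp

noncomputable def kf (s : ℝ) : ℝ := (1 + s ^ 2) ^ (1 / 8 : ℝ)

lemma kf_ge (s : ℝ) : 1 ≤ kf s := Real.one_le_rpow (by nlinarith [sq_nonneg s]) (by norm_num)
lemma kf_pos (s : ℝ) : 0 < kf s := lt_of_lt_of_le one_pos (kf_ge s)
lemma kf_8 (s : ℝ) : kf s ^ 8 = 1 + s ^ 2 := by
  rw [kf, ← Real.rpow_natCast, ← Real.rpow_mul (by positivity)]; norm_num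
lemma kf_4 (s : ℝ) : kf s ^ 4 ≤ 1 + |s| := by
  refine abs_le_of_sq_le_sq' ?_ (by positivity) |>.2
  have := kf_8 s
  have h2 : (kf s ^ 4) ^ 2 = 1 + s ^ 2 := by rw [← this]; ring
  rw [h2]; nlinarith [abs_nonneg s, sq_abs s]
lemma kf_4' (s : ℝ) : |s| ≤ kf s ^ 4 := by
  refine abs_le_of_sq_le_sq' ?_ (by have := kf_pos s; positivity) |>.2
  have := kf_8 s
  have h2 : (kf s ^ 4) ^ 2 = 1 + s ^ 2 := by rw [← this]; ring
  rw [h2]; nlinarith [abs_nonneg s, sq_abs s]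
lemma kf_contDiff : ContDiff ℝ 1 kf := by
  unfold kf
  refine ContDiff.rpow_const_of_ne (by fun_prop) (fun x => by positivity)
lemma kf_deriv (s : ℝ) : HasDerivAt kf (s / 4 / kf s ^ 7) s := by
  have h1 : HasDerivAt (fun s : ℝ => 1 + s ^ 2) (2 * s) s := by
    simpa using (hasDerivAt_pow 2 s).const_add 1
  have h2 := h1.rpow_const (p := 1 / 8) (Or.inl (by positivity))
  have h3 : (1 + s ^ 2) ^ ((1:ℝ) / 8 - 1) = 1 / kf s ^ 7 := by
    rw [Real.rpow_sub (by positivity), Real.rpow_one]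
    change kf s / _ = _
    rw [← kf_8 s]
    have := kf_pos s
    field_simp
  rw [h3] at h2
  refine h2.congr_deriv ?_
  ring

lemma kf_pow_fderiv {w : E2 → ℝ} (hw : ContDiff ℝ 1 w) (n : ℕ) (x : E2) :
    ‖fderiv ℝ (fun y => kf (w y) ^ (n + 1)) x‖ ≤ (n + 1) * (‖fderiv ℝ w x‖ / kf (w x) ^ 3 * kf (w x) ^ n) := by
  have hwx := ((hw.differentiable (by norm_num)) x).hasFDerivAt
  have h1 := ((kf_deriv (w x)).pow (n + 1)).comp_hasFDerivAt x hwx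
  have h2 : fderiv ℝ (fun y => kf (w y) ^ (n + 1)) x = _ := h1.fderiv
  rw [h2, norm_smul]
  have hk := kf_pos (w x)
  have h4 := kf_4' (w x)
  simp only [Nat.add_sub_cancel, norm_mul, norm_div, norm_pow, Real.norm_eq_abs, abs_of_pos hk]
  have h5 : |w x| / |(4:ℝ)| / kf (w x) ^ 7 ≤ 1 / kf (w x) ^ 3 := by
    rw [div_div, div_le_div_iff₀ (by positivity) (by positivity), abs_of_pos (by norm_num : (0:ℝ) < 4)]
    have : kf (w x) ^ 7 = kf (w x) ^ 4 * kf (w x) ^ 3 := by ring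
    rw [this]
    have : 0 < kf (w x) ^ 3 := by positivity
    nlinarith [abs_nonneg (w x)]
  have h6 : |((n + 1 : ℕ) : ℝ)| = n + 1 := by rw [abs_of_nonneg (by positivity)]; push_cast; ring
  rw [h6]
  calc _ ≤ ((n:ℝ) + 1) * kf (w x) ^ n * (1 / kf (w x) ^ 3) * ‖fderiv ℝ w x‖ := by gcongr
    _ = _ := by ring

noncomputable def psi (s : ℝ) : ℝ := ∫ t in (0:ℝ)..s, 1 / kf t ^ 6
noncomputable def LL : ℝ := ∫ t, 1 / kf t ^ 6

lemma kf6_cont : Continuous (fun t => 1 / kf t ^ 6) :=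
  continuous_const.div (kf_contDiff.continuous.pow 6) (fun t => (pow_pos (kf_pos t) 6).ne')
lemma kf6_int : Integrable (fun t => 1 / kf t ^ 6) := by
  have h := integrable_rpow_neg_one_add_norm_sq (E := ℝ) (μ := volume) (r := 3/2) (by norm_num)
  refine h.congr (.of_forall fun t => ?_)
  simp only [Real.norm_eq_abs, sq_abs]
  rw [kf, ← Real.rpow_natCast _ 6, ← Real.rpow_mul (by positivity), one_div, ← Real.rpow_neg (by positivity)]
  norm_num
lemma LL_nonneg : 0 ≤ LL := integral_nonneg fun t => by have := kf_pos t; positivity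
lemma psi_le (s : ℝ) : |psi s| ≤ LL := by
  have h0 : ∀ t, 0 ≤ 1 / kf t ^ 6 := fun t => by have := kf_pos t; positivity
  refine (intervalIntegral.norm_integral_le_integral_norm_uIoc (f := fun t => 1 / kf t ^ 6)).trans ?_
  simp only [Real.norm_of_nonneg (h0 _)]
  exact setIntegral_le_integral kf6_int (.of_forall h0)
lemma psi_deriv (s : ℝ) : HasDerivAt psi (1 / kf s ^ 6) s :=
  (kf6_cont.integral_hasStrictDerivAt 0 s).hasDerivAt
lemma psi_contDiff : ContDiff ℝ 1 psi := by
  rw [contDiff_one_iff_deriv]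
  refine ⟨fun s => (psi_deriv s).differentiableAt, ?_⟩
  rw [funext fun s => (psi_deriv s).deriv]
  exact kf6_cont

lemma fd_sq (L : E2 →L[ℝ] ℝ) : ‖L‖ ^ 2 = ∑ i : Fin 2, L (EuclideanSpace.single i 1) ^ 2 := by
  set v := (InnerProductSpace.toDual ℝ E2).symm L with hv
  have h1 : ‖v‖ = ‖L‖ := by simp [hv]
  rw [← h1, EuclideanSpace.norm_sq_eq]
  refine Finset.sum_congr rfl fun i _ => ?_
  have : L (EuclideanSpace.single i 1) = v i := by
    have := InnerProductSpace.toDual_symm_apply (𝕜 := ℝ) (x := (EuclideanSpace.single i 1 : E2)) (y := L)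
    rw [← this, ← hv, real_inner_comm]
    simp [EuclideanSpace.inner_single_left]
  rw [this, Real.norm_eq_abs, sq_abs]

lemma energy {w : E2 → ℝ} {M : ℝ} (hw : ContDiff ℝ 2 w)
    (hp : ∀ x i, w (x + EuclideanSpace.single i (1:ℝ)) = w x)
    (hM : (∫ x in fundDom, |lap2 w x|) ≤ M) :
    ∫ x in fundDom, (‖fderiv ℝ w x‖ / kf (w x) ^ 3) ^ 2 ≤ LL * M := by
  have hw1 : ContDiff ℝ 1 w := hw.of_le (by norm_num)
  have hD : ∀ i : Fin 2, ContDiff ℝ 1 fun x => fderiv ℝ w x (EuclideanSpace.single i (1:ℝ)) := fun i =>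
    (hw.fderiv_right (m := 1) (by norm_num)).clm_apply contDiff_const
  have hpsi : ContDiff ℝ 1 fun x => psi (w x) := psi_contDiff.comp hw1
  have hF : ∀ i : Fin 2, ContDiff ℝ 1 fun x => psi (w x) * fderiv ℝ w x (EuclideanSpace.single i (1:ℝ)) := fun i =>
    hpsi.mul (hD i)
  have hDp : ∀ x j, fderiv ℝ w (x + EuclideanSpace.single j (1:ℝ)) = fderiv ℝ w x := by
    intro x j
    rw [← fderiv_comp_add_right]
    congr 1
    ext y
    exact hp y j
  have hI : ∀ i : Fin 2, _ := fun i => ibp (hF i) (fun x j => by simp only [hp, hDp]) i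
  have hcD2 : ∀ i : Fin 2, Continuous fun x => fderiv ℝ (fun y => fderiv ℝ w y (EuclideanSpace.single i (1:ℝ))) x
    (EuclideanSpace.single i (1:ℝ)) := fun i => (cont_fd (hD i)).clm_apply continuous_const
  have hlap : Continuous (lap2 w) := by
    unfold lap2
    exact continuous_finsetSum _ fun i _ => hcD2 i
  have hcF : ∀ i : Fin 2, Continuous fun x => fderiv ℝ (fun x => psi (w x) * fderiv ℝ w x (EuclideanSpace.single i (1:ℝ))) x (EuclideanSpace.single i (1:ℝ)) :=
    fun i => (cont_fd (hF i)).clm_apply continuous_const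
  have hpt : ∀ x, (‖fderiv ℝ w x‖ / kf (w x) ^ 3) ^ 2 = (∑ i : Fin 2, fderiv ℝ (fun x => psi (w x) * fderiv ℝ w x (EuclideanSpace.single i (1:ℝ))) x (EuclideanSpace.single i (1:ℝ))) - psi (w x) * lap2 w x := by
    intro x
    have hd : ∀ i : Fin 2, fderiv ℝ (fun x => psi (w x) * fderiv ℝ w x (EuclideanSpace.single i (1:ℝ))) x (EuclideanSpace.single i (1:ℝ)) = psi (w x) * fderiv ℝ (fun y => fderiv ℝ w y (EuclideanSpace.single i (1:ℝ))) x (EuclideanSpace.single i (1:ℝ)) + 1 / kf (w x) ^ 6 * fderiv ℝ w x (EuclideanSpace.single i (1:ℝ)) ^ 2 := by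
      intro i
      have a1 := (psi_deriv (w x)).comp_hasFDerivAt x ((hw1.differentiable (by norm_num)) x).hasFDerivAt
      have a2 := (((hD i).differentiable (by norm_num)) x).hasFDerivAt
      have a3 : fderiv ℝ (fun x => psi (w x) * fderiv ℝ w x (EuclideanSpace.single i (1:ℝ))) x = _ := (a1.mul a2).fderiv
      rw [a3]
      simp [Function.comp]
      ring
    simp only [hd, lap2, Finset.sum_add_distrib, ← Finset.mul_sum, ← fd_sq]
    ring
  simp only [hpt]
  have i1 : Integrable (fun x => ∑ i : Fin 2, fderiv ℝ (fun x => psi (w x) * fderiv ℝ w x (EuclideanSpace.single i (1:ℝ))) x (EuclideanSpace.single i (1:ℝ))) (volume.restrict fundDom) :=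
    integrable_finset_sum _ fun i _ => int_fund (hcF i)
  have i2 : Integrable (fun x => psi (w x) * lap2 w x) (volume.restrict fundDom) := int_fund (hpsi.continuous.mul hlap)
  rw [integral_sub i1 i2, integral_finset_sum _ (fun i _ => int_fund (hcF i)), Finset.sum_congr rfl fun i _ => hI i]
  simp only [Finset.sum_const_zero, zero_sub]
  refine (neg_le_abs _).trans ((norm_integral_le_integral_norm (_ : E2 → ℝ)).trans ?_)
  calc _ ≤ ∫ x in fundDom, LL * |lap2 w x| := by
        refine integral_mono i2.norm ((int_fund hlap.abs).const_mul _) fun x => ?_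
        simp only [norm_mul, Real.norm_eq_abs]
        exact mul_le_mul_of_nonneg_right (psi_le _) (abs_nonneg _)
    _ = LL * ∫ x in fundDom, |lap2 w x| := integral_const_mul _ _
    _ ≤ _ := mul_le_mul_of_nonneg_left hM LL_nonneg

noncomputable def mom (w : E2 → ℝ) (n : ℕ) : ℝ := ∫ x in fundDom, kf (w x) ^ (2 * n)

lemma fund_one : ∫ x in fundDom, (1:ℝ) = 1 := by
  rw [map_fund]; simp

lemma kw_cont {w : E2 → ℝ} (hw : Continuous w) (n : ℕ) : Continuous fun x => kf (w x) ^ n :=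
  (kf_contDiff.continuous.comp hw).pow n

lemma mom_ge {w : E2 → ℝ} (hw : Continuous w) (n : ℕ) : 1 ≤ mom w n := by
  rw [← fund_one]
  exact integral_mono (int_fund continuous_const) (int_fund (kw_cont hw _)) fun x => one_le_pow₀ (kf_ge _)

lemma mixed {w : E2 → ℝ} {K : ℝ} (hw : ContDiff ℝ 1 w)
    (hK : ∫ x in fundDom, (‖fderiv ℝ w x‖ / kf (w x) ^ 3) ^ 2 ≤ K) (n : ℕ) (l : ℝ) (hl : 0 < l) :
    ∫ x in fundDom, ‖fderiv ℝ w x‖ / kf (w x) ^ 3 * kf (w x) ^ n ≤ l * K + mom w n / l := by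
  have hw0 := hw.continuous
  have c1 : Continuous fun x => ‖fderiv ℝ w x‖ / kf (w x) ^ 3 :=
    (cont_fd hw).norm.div (kw_cont hw0 3) fun x => (pow_pos (kf_pos _) 3).ne'
  have c2 := kw_cont hw0
  have i1 : Integrable (fun x => l * (‖fderiv ℝ w x‖ / kf (w x) ^ 3) ^ 2) (volume.restrict fundDom) :=
    (int_fund (c1.pow 2)).const_mul l
  have i2 := (int_fund (c2 (2 * n))).div_const l
  calc _ ≤ ∫ x in fundDom, (l * (‖fderiv ℝ w x‖ / kf (w x) ^ 3) ^ 2 + kf (w x) ^ (2 * n) / l) := by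
        refine integral_mono (int_fund (c1.mul (c2 n))) (i1.add i2) fun x => ?_
        have hk := pow_pos (kf_pos (w x)) n
        have hG : 0 ≤ ‖fderiv ℝ w x‖ / kf (w x) ^ 3 := by have := kf_pos (w x); positivity
        change ‖fderiv ℝ w x‖ / kf (w x) ^ 3 * kf (w x) ^ n ≤ l * (‖fderiv ℝ w x‖ / kf (w x) ^ 3) ^ 2 + kf (w x) ^ (2 * n) / l
        rw [mul_comm 2 n, pow_mul]
        generalize ‖fderiv ℝ w x‖ / kf (w x) ^ 3 = g at *
        generalize kf (w x) ^ n = k at *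
        have : l * g ^ 2 + k ^ 2 / l = ((l * g) ^ 2 + k ^ 2) / l := by field_simp
        rw [this, le_div_iff₀ hl]
        nlinarith [sq_nonneg (l * g - k), mul_nonneg (mul_nonneg hl.le hG) hk.le]
    _ = l * (∫ x in fundDom, (‖fderiv ℝ w x‖ / kf (w x) ^ 3) ^ 2) + mom w n / l := by
        rw [integral_add i1 i2, integral_const_mul, integral_div]; rfl
    _ ≤ _ := by gcongr

lemma mom_step {w : E2 → ℝ} {K : ℝ} (hw : ContDiff ℝ 1 w)
    (hK : ∫ x in fundDom, (‖fderiv ℝ w x‖ / kf (w x) ^ 3) ^ 2 ≤ K) (n : ℕ) (l : ℝ) (hl : 0 < l) :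
    mom w (n + 1) ≤ ((∫ x in fundDom, kf (w x) ^ (n + 1)) + (n + 1) * (l * K + mom w n / l)) ^ 2 := by
  have hw0 := hw.continuous
  have hf : ContDiff ℝ 1 fun x => kf (w x) ^ (n + 1) := (kf_contDiff.comp hw).pow _
  have c1 : Continuous fun x => ‖fderiv ℝ w x‖ / kf (w x) ^ 3 :=
    (cont_fd hw).norm.div (kw_cont hw0 3) fun x => (pow_pos (kf_pos _) 3).ne'
  have h1 := sobolev hf
  have e1 : ∀ x, (kf (w x) ^ (n + 1)) ^ 2 = kf (w x) ^ (2 * (n + 1)) := fun x => by ring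
  have e2 : ∀ x, |kf (w x) ^ (n + 1)| = kf (w x) ^ (n + 1) := fun x => abs_of_pos (pow_pos (kf_pos _) _)
  simp only [e1, e2] at h1
  refine h1.trans ?_
  have h2 : ∫ x in fundDom, ‖fderiv ℝ (fun y => kf (w y) ^ (n + 1)) x‖ ≤ (n + 1) * (l * K + mom w n / l) := by
    refine (integral_mono (int_fund (cont_fd hf).norm) ((int_fund (c1.mul (kw_cont hw0 n))).const_mul ((n:ℝ) + 1)) (kf_pow_fderiv hw n)).trans ?_
    rw [integral_const_mul]
    exact mul_le_mul_of_nonneg_left (mixed hw hK n l hl) (by positivity)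
  have h3 : 0 ≤ ∫ x in fundDom, kf (w x) ^ (n + 1) := integral_nonneg fun x => (pow_pos (kf_pos _) _).le
  have h4 : 0 ≤ ∫ x in fundDom, ‖fderiv ℝ (fun y => kf (w y) ^ (n + 1)) x‖ := integral_nonneg fun x => norm_nonneg _
  gcongr

lemma mom_base {w : E2 → ℝ} {K : ℝ} (hw : ContDiff ℝ 1 w) (h0 : ∫ x in fundDom, w x = 0)
    (hK0 : 0 ≤ K)
    (hK : ∫ x in fundDom, (‖fderiv ℝ w x‖ / kf (w x) ^ 3) ^ 2 ≤ K) :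
    mom w 4 ≤ 16 * (36 * (K + 2) ^ 2) ^ 4 := by
  have hw0 := hw.continuous
  set l := √(mom w 3) with hl
  have h3 := mom_ge hw0 3
  have hl1 : 1 ≤ l := by rw [hl]; exact Real.one_le_sqrt.2 h3
  have hl2 : l ^ 2 = mom w 3 := Real.sq_sqrt (by linarith)
  have hdiv : mom w 3 / l = l := by rw [← hl2]; field_simp
  have hG := mixed hw hK 3 l (by linarith)
  have e1 : ∀ x, ‖fderiv ℝ w x‖ / kf (w x) ^ 3 * kf (w x) ^ 3 = ‖fderiv ℝ w x‖ := fun x =>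
    div_mul_cancel₀ _ (pow_pos (kf_pos _) 3).ne'
  simp only [e1, hdiv] at hG
  have hP := poincare hw h0
  have hs := mom_step hw hK 3 l (by linarith)
  have h4 : ∫ x in fundDom, kf (w x) ^ 4 ≤ 1 + ∫ x in fundDom, |w x| := by
    rw [← fund_one, ← integral_add (int_fund continuous_const) (int_fund hw0.abs)]
    exact integral_mono (int_fund (kw_cont hw0 4)) (int_fund (continuous_const.add hw0.abs)) fun x => kf_4 _
  have h40 : 0 ≤ ∫ x in fundDom, kf (w x) ^ 4 := integral_nonneg fun x => (pow_pos (kf_pos _) _).le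
  rw [hdiv] at hs
  norm_num at hs
  set c := 36 * (K + 2) ^ 2 with hc
  have hs2 : mom w 4 ≤ c * mom w 3 := by
    refine hs.trans ?_
    have : c * mom w 3 = (6 * (K + 2) * l) ^ 2 := by rw [hc, ← hl2]; ring
    rw [this]
    have : 0 ≤ l * K := by positivity
    refine pow_le_pow_left₀ (by positivity) ?_ 2
    nlinarith
  have hc0 : 0 < c := by positivity
  have h5 : c * mom w 3 ≤ mom w 4 / 2 + 8 * c ^ 4 := by
    have j1 := (int_fund (kw_cont hw0 (2 * 4))).div_const 2
    have e : mom w 4 / 2 + 8 * c ^ 4 = ∫ x in fundDom, (kf (w x) ^ (2 * 4) / 2 + (8 * c ^ 4) * 1) := by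
      rw [integral_add j1 (int_fund continuous_const), integral_const_mul, fund_one, integral_div]
      simp [mom]
    rw [e, mom, ← integral_const_mul]
    refine integral_mono ((int_fund (kw_cont hw0 _)).const_mul c) (j1.add (int_fund continuous_const)) fun x => ?_
    change c * kf (w x) ^ (2 * 3) ≤ kf (w x) ^ (2 * 4) / 2 + (8 * c ^ 4) * 1
    rw [pow_mul, pow_mul]
    have ht : 0 < kf (w x) ^ 2 := pow_pos (kf_pos _) 2
    generalize kf (w x) ^ 2 = t at *
    rcases le_total t (2 * c) with h | h
    · have : t ^ 3 ≤ (2 * c) ^ 3 := by gcongr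
      have : 0 ≤ t ^ 4 / 2 := by positivity
      nlinarith
    · have : 0 < t ^ 3 := by positivity
      have : 0 < c ^ 4 := by positivity
      nlinarith
  linarith

lemma mom_all (K : ℝ) (hK0 : 0 ≤ K) (n : ℕ) : ∃ C : ℝ, ∀ w : E2 → ℝ, ContDiff ℝ 1 w →
    (∫ x in fundDom, w x = 0) →
    (∫ x in fundDom, (‖fderiv ℝ w x‖ / kf (w x) ^ 3) ^ 2 ≤ K) → mom w (n + 4) ≤ C := by
  induction n with
  | zero => exact ⟨_, fun w hw h0 hK => mom_base hw h0 hK0 hK⟩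
  | succ n ih =>
    obtain ⟨C, hC⟩ := ih
    refine ⟨(C + ((n:ℝ) + 4 + 1) * (K + C)) ^ 2, fun w hw h0 hK => ?_⟩
    have h1 := hC w hw h0 hK
    have hs := mom_step hw hK (n + 4) 1 one_pos
    have hw0 := hw.continuous
    have h2 : ∫ x in fundDom, kf (w x) ^ (n + 4 + 1) ≤ mom w (n + 4) :=
      integral_mono (int_fund (kw_cont hw0 _)) (int_fund (kw_cont hw0 _)) fun x =>
        pow_le_pow_right₀ (kf_ge _) (by omega)
    have h40 : 0 ≤ ∫ x in fundDom, kf (w x) ^ (n + 4 + 1) := integral_nonneg fun x => (pow_pos (kf_pos _) _).le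
    have := mom_ge hw0 (n + 4)
    rw [show n + 1 + 4 = n + 4 + 1 by ring]
    refine hs.trans ?_
    push_cast
    rw [one_mul, div_one]
    refine pow_le_pow_left₀ (by positivity) ?_ 2
    gcongr
    exact h2.trans h1

end helpers

theorem stmt10 (q M : ℝ) (hq : 1 < q) (hq2 : q < 2) (hM : 0 < M) :
    ∃ Cq : ℝ, 0 < Cq ∧ ∀ w : EuclideanSpace ℝ (Fin 2) → ℝ,
      ContDiff ℝ (⊤ : ℕ∞) w →
      (∀ x i, w (x + EuclideanSpace.single i (1:ℝ)) = w x) →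
      (∫ x in fundDom, w x) = 0 →
      (∫ x in fundDom, |lap2 w x|) ≤ M →
      (∫ x in fundDom, ‖gradient w x‖ ^ q) ^ (1/q) ≤ Cq := by
  obtain ⟨N, hN⟩ := exists_nat_ge (6 * (q / (2 - q)))
  have hK0 : 0 ≤ LL * M := mul_nonneg LL_nonneg hM.le
  obtain ⟨C, hC⟩ := mom_all (LL * M) hK0 N
  refine ⟨(LL * M + |C| + 1) ^ (1 / q), by positivity, fun w hw hp h0 hL => ?_⟩
  have hw1 : ContDiff ℝ 1 w := hw.of_le (by exact_mod_cast le_top)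
  have hw2 : ContDiff ℝ 2 w := contDiff_infty.1 hw 2
  have hE := energy hw2 hp hL
  have hm := hC w hw1 h0 hE
  have hw0 := hw1.continuous
  have hg : ∀ x, ‖gradient w x‖ = ‖fderiv ℝ w x‖ := fun x => by simp [gradient]
  simp only [hg]
  have c1 : Continuous fun x => ‖fderiv ℝ w x‖ / kf (w x) ^ 3 :=
    (cont_fd hw1).norm.div (kw_cont hw0 3) fun x => (pow_pos (kf_pos _) 3).ne'
  refine Real.rpow_le_rpow (integral_nonneg fun x => by positivity) ?_ (by positivity)
  have key : ∫ x in fundDom, ‖fderiv ℝ w x‖ ^ q ≤ ∫ x in fundDom, ((‖fderiv ℝ w x‖ / kf (w x) ^ 3) ^ 2 + kf (w x) ^ (2 * (N + 4))) := by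
    refine integral_mono (int_fund ((cont_fd hw1).norm.rpow_const fun x => Or.inr (by linarith)))
      ((int_fund (c1.pow 2)).add (int_fund (kw_cont hw0 _))) fun x => ?_
    change ‖fderiv ℝ w x‖ ^ q ≤ (‖fderiv ℝ w x‖ / kf (w x) ^ 3) ^ 2 + kf (w x) ^ (2 * (N + 4))
    have hk1 := kf_ge (w x)
    have hG := norm_nonneg (fderiv ℝ w x)
    generalize ‖fderiv ℝ w x‖ = G at *
    generalize kf (w x) = k at *
    have hk0 : 0 < k := by linarith
    have h2q : 0 < 2 - q := by linarith
    rcases le_total G (k ^ (6 / (2 - q))) with h | h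
    · have : G ^ q ≤ k ^ (2 * (N + 4)) := by
        calc G ^ q ≤ (k ^ (6 / (2 - q))) ^ q := Real.rpow_le_rpow hG h (by linarith)
          _ = k ^ (6 * (q / (2 - q))) := by rw [← Real.rpow_mul hk0.le]; congr 1; ring
          _ ≤ k ^ ((2 * (N + 4) : ℕ) : ℝ) := by
              refine Real.rpow_le_rpow_of_exponent_le hk1 ?_
              push_cast
              have : (0:ℝ) ≤ N := by positivity
              linarith
          _ = _ := Real.rpow_natCast _ _
      have : 0 ≤ (G / k ^ 3) ^ 2 := by positivity
      linarith
    · have hG0 : 0 < G := lt_of_lt_of_le (by positivity) h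
      have h1 : k ^ 6 ≤ G ^ (2 - q) := by
        calc k ^ 6 = (k ^ (6 / (2 - q))) ^ (2 - q) := by
              rw [← Real.rpow_mul hk0.le, div_mul_cancel₀ _ h2q.ne']
              exact_mod_cast (Real.rpow_natCast k 6).symm
          _ ≤ _ := Real.rpow_le_rpow (by positivity) h h2q.le
      have h2 : G ^ q * G ^ (2 - q) = G ^ 2 := by
        rw [← Real.rpow_add hG0]
        norm_num
      have : G ^ q ≤ (G / k ^ 3) ^ 2 := by
        rw [div_pow, ← pow_mul, le_div_iff₀ (by positivity), ← h2]
        exact mul_le_mul_of_nonneg_left h1 (by positivity)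
      have : 0 < k ^ (2 * (N + 4)) := by positivity
      linarith
  refine key.trans ?_
  have i1 : Integrable (fun x => (‖fderiv ℝ w x‖ / kf (w x) ^ 3) ^ 2) (volume.restrict fundDom) :=
    int_fund (c1.pow 2)
  rw [integral_add i1 (int_fund (kw_cont hw0 _))]
  have := le_abs_self C
  unfold mom at hm
  linarith
end

section
/- Let u₁, u₂ : ℝ² ∖ {0} → ℝ be a radial topological solution of Δu₁ + e^{u₂}(1-e^{u₁}) = 4πν₁δ₀, Δu₂ + e^{u₁}(1-e^{u₂}) = 4πν₂δ₀ with u_i ≤ 0 and u_i → 0 exponentially at infinity, and suppose 1 - e^{u_i} ∈ L¹(ℝ²). Then ∫_{ℝ²}(1-e^{u₁})(1-e^{u₂}) dx = 4π ν₁ν₂ and ∫_{ℝ²}(1-e^{u_i}) dx = 4π(ν₁ν₂ + ν_i) for i = 1, 2. -/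
open Real Filter MeasureTheory Topology

/-- radial profile -/
noncomputable def prof (u : EuclideanSpace ℝ (Fin 2) → ℝ) (r : ℝ) : ℝ :=
  u (r • EuclideanSpace.single 0 (1:ℝ))

lemma norm_ray (r : ℝ) (hr : 0 ≤ r) :
    ‖r • (EuclideanSpace.single 0 (1:ℝ) : EuclideanSpace ℝ (Fin 2))‖ = r := by
  simp [norm_smul, abs_of_nonneg hr]

lemma prof_norm (u : EuclideanSpace ℝ (Fin 2) → ℝ)
    (hrad : ∀ x y : EuclideanSpace ℝ (Fin 2), ‖x‖ = ‖y‖ → u x = u y) (x) :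
    u x = prof u ‖x‖ :=
  hrad _ _ (norm_ray _ (norm_nonneg x)).symm

lemma prof_smooth (u : EuclideanSpace ℝ (Fin 2) → ℝ)
    (hsm : ContDiffOn ℝ (⊤ : ℕ∞) u {(0 : EuclideanSpace ℝ (Fin 2))}ᶜ) :
    ContDiffOn ℝ (⊤ : ℕ∞) (prof u) (Set.Ioi 0) := by
  unfold prof
  refine hsm.comp (t := {(0 : EuclideanSpace ℝ (Fin 2))}ᶜ) (by fun_prop) ?_
  intro r hr
  simp only [Set.mem_Ioi] at hr
  simp [hr.ne']

lemma prof_deriv (u : EuclideanSpace ℝ (Fin 2) → ℝ)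
    (hsm : ContDiffOn ℝ (⊤ : ℕ∞) u {(0 : EuclideanSpace ℝ (Fin 2))}ᶜ) (r : ℝ) (hr : 0 < r) :
    HasDerivAt (prof u) (deriv (prof u) r) r ∧
    HasDerivAt (deriv (prof u)) (deriv (deriv (prof u)) r) r := by
  have h := prof_smooth u hsm
  have h2 : ContDiffOn ℝ 1 (deriv (prof u)) (Set.Ioi 0) :=
    ((contDiffOn_succ_iff_deriv_of_isOpen (n := 1) isOpen_Ioi).1
      (h.of_le (by norm_num; exact WithTop.coe_le_coe.2 (le_top : (2:ℕ∞) ≤ ⊤)))).2.2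
  exact ⟨((h.differentiableOn (by simp)).differentiableAt (Ioi_mem_nhds hr)).hasDerivAt,
    ((h2.differentiableOn (by simp)).differentiableAt (Ioi_mem_nhds hr)).hasDerivAt⟩

lemma norm_fderiv (y : EuclideanSpace ℝ (Fin 2)) (hy : y ≠ 0) :
    HasFDerivAt (fun y : EuclideanSpace ℝ (Fin 2) => ‖y‖) ((‖y‖)⁻¹ • innerSL ℝ y) y := by
  have h := (hasStrictFDerivAt_norm_sq y).hasFDerivAt.sqrt (by simpa using hy)
  simp only [Real.sqrt_sq (norm_nonneg _)] at h
  refine h.congr_fderiv ?_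
  have hn : ‖y‖ ≠ 0 := norm_ne_zero_iff.2 hy
  ext1 v
  simp only [smul_apply, smul_eq_mul, nsmul_eq_mul]
  push_cast
  field_simp

lemma inner_single (y : EuclideanSpace ℝ (Fin 2)) (i : Fin 2) :
    innerSL ℝ y (EuclideanSpace.single i (1:ℝ)) = y i := by
  simp [EuclideanSpace.inner_single_right]

lemma lap_radial (u : EuclideanSpace ℝ (Fin 2) → ℝ)
    (hsm : ContDiffOn ℝ (⊤ : ℕ∞) u {(0 : EuclideanSpace ℝ (Fin 2))}ᶜ)
    (hrad : ∀ x y : EuclideanSpace ℝ (Fin 2), ‖x‖ = ‖y‖ → u x = u y)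
    (r : ℝ) (hr : 0 < r) :
    HasDerivAt (fun s => s * deriv (prof u) s)
      (r * lap2 u (r • EuclideanSpace.single 0 (1:ℝ))) r := by
  set x : EuclideanSpace ℝ (Fin 2) := r • EuclideanSpace.single 0 (1:ℝ) with hx
  have hxn : ‖x‖ = r := norm_ray r hr.le
  have hx0 : x ≠ 0 := by
    intro h; rw [h, norm_zero] at hxn; exact hr.ne hxn
  have hu : u = fun y => prof u ‖y‖ := funext (prof_norm u hrad)
  have h1 : ∀ y : EuclideanSpace ℝ (Fin 2), y ≠ 0 → ∀ i : Fin 2,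
      fderiv ℝ u y (EuclideanSpace.single i (1:ℝ)) = (deriv (prof u) ‖y‖ / ‖y‖) * y i := by
    intro y hy i
    have := (prof_deriv u hsm ‖y‖ (norm_pos_iff.2 hy)).1.comp_hasFDerivAt y (norm_fderiv y hy)
    have h2 : HasFDerivAt u (deriv (prof u) ‖y‖ • (‖y‖⁻¹ • innerSL ℝ y)) y := by
      have hu' : u = prof u ∘ norm := hu
      have hu2 := this
      rw [← hu'] at hu2
      exact hu2
    rw [h2.fderiv]
    simp only [smul_apply, inner_single, smul_eq_mul]
    ring
  have hh : HasDerivAt (fun s => deriv (prof u) s / s)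
      ((deriv (deriv (prof u)) r * r - deriv (prof u) r * 1) / r ^ 2) r :=
    (prof_deriv u hsm r hr).2.div (hasDerivAt_id r) hr.ne'
  have h2 : ∀ i : Fin 2, fderiv ℝ (fun y => fderiv ℝ u y (EuclideanSpace.single i (1:ℝ))) x
      (EuclideanSpace.single i (1:ℝ)) = deriv (prof u) r / r +
        x i * (((deriv (deriv (prof u)) r * r - deriv (prof u) r * 1) / r ^ 2) * (r⁻¹ * x i)) := by
    intro i
    have hev : (fun y => fderiv ℝ u y (EuclideanSpace.single i (1:ℝ))) =ᶠ[𝓝 x]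
        fun y => (deriv (prof u) ‖y‖ / ‖y‖) * y i := by
      filter_upwards [isOpen_ne.mem_nhds hx0] with y hy using h1 y hy i
    rw [hev.fderiv_eq]
    have hh' := hh
    rw [← hxn] at hh'
    have hc := hh'.comp_hasFDerivAt x (norm_fderiv x hx0)
    have hp : HasFDerivAt (fun y : EuclideanSpace ℝ (Fin 2) => y i)
        (EuclideanSpace.proj i : EuclideanSpace ℝ (Fin 2) →L[ℝ] ℝ) x :=
      (EuclideanSpace.proj i : EuclideanSpace ℝ (Fin 2) →L[ℝ] ℝ).hasFDerivAt
    have := (hc.mul hp).fderiv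
    simp only [Function.comp_def, hxn] at this
    erw [this]
    simp only [add_apply, smul_apply, inner_single, smul_eq_mul]
    simp
  have h3 : r * lap2 u x = 1 * deriv (prof u) r + r * deriv (deriv (prof u)) r := by
    unfold lap2
    rw [Fin.sum_univ_two, h2, h2]
    have e0 : x 0 = r := by simp [hx]
    have e1 : x 1 = 0 := by simp [hx]
    rw [e0, e1]
    field_simp
    ring
  rw [h3]
  exact (hasDerivAt_id r).mul (prof_deriv u hsm r hr).2

/-- limits of the flux `r f'(r)` -/
lemma flux_bounds (f : ℝ → ℝ) (hf : ∀ r, 0 < r → HasDerivAt f (deriv f r) r)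
    (Q : ℝ → ℝ) (hQ : ∀ r, 0 < r → HasDerivAt (fun s => s * deriv f s) (-Q r) r)
    (hQ0 : ∀ r, 0 < r → 0 ≤ Q r) (r : ℝ) (hr : 0 < r) :
    (f (2 * r) - f r) / Real.log 2 ≤ r * deriv f r ∧
    r * deriv f r ≤ (f r - f (r / 2)) / Real.log 2 := by
  have hanti : AntitoneOn (fun s => s * deriv f s) (Set.Ioi 0) := by
    refine antitoneOn_of_deriv_nonpos (convex_Ioi 0) ?_ ?_ ?_
    · exact fun s hs => (hQ s hs).continuousAt.continuousWithinAt
    · rw [interior_Ioi]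
      exact fun s hs => (hQ s hs).differentiableAt.differentiableWithinAt
    · rw [interior_Ioi]
      intro s hs
      rw [(hQ s hs).deriv]
      linarith [hQ0 s hs]
  have hl : 0 < Real.log 2 := Real.log_pos (by norm_num)
  have key : ∀ a : ℝ, 0 < a → ∃ c ∈ Set.Ioo a (2 * a),
      Real.log 2 * (c * deriv f c) = f (2 * a) - f a := by
    intro a ha
    obtain ⟨c, hc, h⟩ := exists_ratio_hasDerivAt_eq_ratio_slope f (deriv f)
      (show a < 2 * a by linarith)
      (fun x hx => (hf x (by linarith [hx.1])).continuousAt.continuousWithinAt)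
      (fun x hx => hf x (by linarith [hx.1])) Real.log (fun x => x⁻¹)
      (fun x hx => (Real.hasDerivAt_log (by linarith [hx.1])).continuousAt.continuousWithinAt)
      (fun x hx => Real.hasDerivAt_log (by linarith [hx.1]))
    refine ⟨c, hc, ?_⟩
    have hc0 : 0 < c := ha.trans hc.1
    rw [Real.log_mul (by norm_num) ha.ne', add_sub_cancel_right] at h
    field_simp at h
    linarith
  constructor
  · obtain ⟨c, hc, h⟩ := key r hr
    rw [div_le_iff₀ hl, ← h, mul_comm]
    exact mul_le_mul_of_nonneg_right (hanti hr (hr.trans hc.1) hc.1.le) hl.le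
  · obtain ⟨c, hc, h⟩ := key (r / 2) (by linarith)
    rw [show 2 * (r / 2) = r by ring] at hc h
    rw [le_div_iff₀ hl, ← h, mul_comm (Real.log 2)]
    exact mul_le_mul_of_nonneg_right
      (hanti (show 0 < c by linarith [hc.1]) hr hc.2.le) hl.le

lemma flux_top (f : ℝ → ℝ) (hf : ∀ r, 0 < r → HasDerivAt f (deriv f r) r)
    (Q : ℝ → ℝ) (hQ : ∀ r, 0 < r → HasDerivAt (fun s => s * deriv f s) (-Q r) r)
    (hQ0 : ∀ r, 0 < r → 0 ≤ Q r) (hlim : Tendsto f atTop (𝓝 0)) :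
    Tendsto (fun s => s * deriv f s) atTop (𝓝 0) := by
  have h2 : Tendsto (fun r : ℝ => 2 * r) atTop atTop :=
    tendsto_id.const_mul_atTop (by norm_num)
  have h3 : Tendsto (fun r : ℝ => r / 2) atTop atTop :=
    tendsto_id.atTop_div_const (by norm_num)
  refine tendsto_of_tendsto_of_tendsto_of_le_of_le'
    (g := fun r => (f (2 * r) - f r) / Real.log 2)
    (h := fun r => (f r - f (r / 2)) / Real.log 2) ?_ ?_ ?_ ?_
  · simpa using ((hlim.comp h2).sub hlim).div_const (Real.log 2)
  · simpa using (hlim.sub (hlim.comp h3)).div_const (Real.log 2)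
  · filter_upwards [eventually_gt_atTop 0] with r hr using (flux_bounds f hf Q hQ hQ0 r hr).1
  · filter_upwards [eventually_gt_atTop 0] with r hr using (flux_bounds f hf Q hQ hQ0 r hr).2

lemma flux_zero (f : ℝ → ℝ) (hf : ∀ r, 0 < r → HasDerivAt f (deriv f r) r)
    (Q : ℝ → ℝ) (hQ : ∀ r, 0 < r → HasDerivAt (fun s => s * deriv f s) (-Q r) r)
    (hQ0 : ∀ r, 0 < r → 0 ≤ Q r) (m c : ℝ)
    (hlim : Tendsto (fun r => f r - m * Real.log r) (𝓝[>] 0) (𝓝 c)) :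
    Tendsto (fun s => s * deriv f s) (𝓝[>] 0) (𝓝 m) := by
  have hl : 0 < Real.log 2 := Real.log_pos (by norm_num)
  have h2 : Tendsto (fun r : ℝ => 2 * r) (𝓝[>] 0) (𝓝[>] 0) := by
    refine tendsto_nhdsWithin_iff.2 ⟨?_, ?_⟩
    · have : Tendsto (fun r : ℝ => 2 * r) (𝓝 0) (𝓝 (2 * 0)) := Continuous.tendsto (by fun_prop) 0
      rw [mul_zero] at this
      exact this.mono_left nhdsWithin_le_nhds
    · filter_upwards [self_mem_nhdsWithin] with r hr
      simpa using hr
  have h3 : Tendsto (fun r : ℝ => r / 2) (𝓝[>] 0) (𝓝[>] 0) := by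
    refine tendsto_nhdsWithin_iff.2 ⟨?_, ?_⟩
    · have : Tendsto (fun r : ℝ => r / 2) (𝓝 0) (𝓝 (0 / 2)) := Continuous.tendsto (by fun_prop) 0
      rw [zero_div] at this
      exact this.mono_left nhdsWithin_le_nhds
    · filter_upwards [self_mem_nhdsWithin] with r hr
      simpa using hr
  refine tendsto_of_tendsto_of_tendsto_of_le_of_le'
    (g := fun r => (f (2 * r) - f r) / Real.log 2)
    (h := fun r => (f r - f (r / 2)) / Real.log 2) ?_ ?_ ?_ ?_
  · have := (((hlim.comp h2).sub hlim).div_const (Real.log 2)).add_const m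
    rw [sub_self, zero_div, zero_add] at this
    refine this.congr' ?_
    filter_upwards [self_mem_nhdsWithin] with r hr
    have hr' : r ≠ 0 := ne_of_gt hr
    simp only [Function.comp_def]
    rw [Real.log_mul (by norm_num) hr']
    field_simp
    ring
  · have := ((hlim.sub (hlim.comp h3)).div_const (Real.log 2)).add_const m
    rw [sub_self, zero_div, zero_add] at this
    refine this.congr' ?_
    filter_upwards [self_mem_nhdsWithin] with r hr
    have hr' : r ≠ 0 := ne_of_gt hr
    simp only [Function.comp_def]
    rw [Real.log_div hr' (by norm_num)]
    field_simp
    ring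
  · filter_upwards [self_mem_nhdsWithin] with r hr using (flux_bounds f hf Q hQ hQ0 r hr).1
  · filter_upwards [self_mem_nhdsWithin] with r hr using (flux_bounds f hf Q hQ hQ0 r hr).2

/-- FTC on `(0, ∞)` with one sided limit at `0`. -/
lemma ftc_pos (F F' : ℝ → ℝ) (a b : ℝ) (hF : ∀ r, 0 < r → HasDerivAt F (F' r) r)
    (hpos : ∀ r, 0 < r → 0 ≤ F' r) (h0 : Tendsto F (𝓝[>] 0) (𝓝 a))
    (h1 : Tendsto F atTop (𝓝 b)) :
    IntegrableOn F' (Set.Ioi 0) ∧ ∫ r in Set.Ioi (0:ℝ), F' r = b - a := by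
  have hc : ContinuousWithinAt (Function.update F 0 a) (Set.Ici 0) 0 := by
    refine continuousWithinAt_update_same.mpr ?_
    rwa [Set.Ici_sdiff_left]
  have hd : ∀ r ∈ Set.Ioi (0:ℝ), HasDerivAt (Function.update F 0 a) (F' r) r := by
    intro r hr
    refine (hF r hr).congr_of_eventuallyEq ?_
    filter_upwards [Ioi_mem_nhds hr] with s hs
    exact Function.update_of_ne (ne_of_gt hs) _ _
  have ht : Tendsto (Function.update F 0 a) atTop (𝓝 b) := by
    refine h1.congr' ?_
    filter_upwards [eventually_gt_atTop 0] with s hs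
    exact (Function.update_of_ne (ne_of_gt hs) _ _).symm
  refine ⟨integrableOn_Ioi_deriv_of_nonneg hc hd hpos ht, ?_⟩
  rw [integral_Ioi_of_hasDerivAt_of_nonneg hc hd hpos ht]
  simp

lemma polar_int (F : ℝ → ℝ) :
    ∫ x : EuclideanSpace ℝ (Fin 2), F ‖x‖ = 2 * π * ∫ r in Set.Ioi (0:ℝ), r * F r := by
  rw [integral_fun_norm_addHaar]
  simp [Measure.real, EuclideanSpace.volume_ball_fin_two, Real.pi_nonneg]
  ring

lemma ray_zero : Tendsto (fun r : ℝ => r • (EuclideanSpace.single 0 (1:ℝ) : EuclideanSpace ℝ (Fin 2)))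
    (𝓝[>] 0) (𝓝[≠] 0) := by
  refine tendsto_nhdsWithin_iff.2 ⟨?_, ?_⟩
  · have : Tendsto (fun r : ℝ => r • (EuclideanSpace.single 0 (1:ℝ) : EuclideanSpace ℝ (Fin 2)))
      (𝓝 0) (𝓝 ((0:ℝ) • (EuclideanSpace.single 0 (1:ℝ) : EuclideanSpace ℝ (Fin 2)))) :=
      Continuous.tendsto (by fun_prop) 0
    rw [zero_smul] at this
    exact this.mono_left nhdsWithin_le_nhds
  · filter_upwards [self_mem_nhdsWithin] with r hr
    have : r ≠ 0 := ne_of_gt hr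
    simp [this]

lemma prof_sing (u : EuclideanSpace ℝ (Fin 2) → ℝ) (m c : ℝ)
    (h : Tendsto (fun x => u x - m * Real.log ‖x‖)
      (𝓝[≠] (0 : EuclideanSpace ℝ (Fin 2))) (𝓝 c)) :
    Tendsto (fun r => prof u r - m * Real.log r) (𝓝[>] 0) (𝓝 c) := by
  refine (h.comp ray_zero).congr' ?_
  filter_upwards [self_mem_nhdsWithin] with r hr
  simp only [Function.comp_def, norm_ray r (le_of_lt hr)]
  rfl

lemma decay_sq (a : ℝ) (ha : 0 < a) (C : ℝ) :
    Tendsto (fun r : ℝ => r ^ 2 * (C * Real.exp (-a * r))) atTop (𝓝 0) := by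
  have h := (Real.tendsto_pow_mul_exp_neg_atTop_nhds_zero 2).comp
    ((tendsto_id (α := ℝ) (x := atTop)).const_mul_atTop ha)
  have h2 := h.const_mul (C / a ^ 2)
  rw [mul_zero] at h2
  refine h2.congr fun r => ?_
  simp only [Function.comp_def, id]
  rw [neg_mul]
  field_simp

lemma one_sub_exp_bounds (t : ℝ) (ht : t ≤ 0) :
    0 ≤ 1 - Real.exp t ∧ 1 - Real.exp t ≤ 1 ∧ 1 - Real.exp t ≤ |t| := by
  refine ⟨by linarith [Real.exp_le_one_iff.2 ht], by linarith [Real.exp_pos t], ?_⟩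
  rw [abs_of_nonpos ht]
  linarith [Real.add_one_le_exp t]

lemma radial_core (f g : ℝ → ℝ) (ν₁ ν₂ : ℕ) (c₁ c₂ C a : ℝ)
    (hz1 : Tendsto (fun r => f r - 2 * (ν₁ : ℝ) * Real.log r) (𝓝[>] 0) (𝓝 c₁))
    (hz2 : Tendsto (fun r => g r - 2 * (ν₂ : ℝ) * Real.log r) (𝓝[>] 0) (𝓝 c₂))
    (hd1 : ∀ r, 0 < r → HasDerivAt f (deriv f r) r)
    (hd2 : ∀ r, 0 < r → HasDerivAt g (deriv g r) r)
    (hn1 : ∀ r, f r ≤ 0) (hn2 : ∀ r, g r ≤ 0)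
    (hP1 : ∀ r, 0 < r → HasDerivAt (fun s => s * deriv f s)
      (-(r * (Real.exp (g r) * (1 - Real.exp (f r))))) r)
    (hP2 : ∀ r, 0 < r → HasDerivAt (fun s => s * deriv g s)
      (-(r * (Real.exp (f r) * (1 - Real.exp (g r))))) r)
    (hdec : ∀ r : ℝ, 1 ≤ r → |f r| + |g r| ≤ C * Real.exp (-a * r))
    (hsq : Tendsto (fun r : ℝ => r ^ 2 * (C * Real.exp (-a * r))) atTop (𝓝 0))
    (ht1 : Tendsto f atTop (𝓝 0)) (ht2 : Tendsto g atTop (𝓝 0)) :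
    (2 * π * (∫ r in Set.Ioi (0:ℝ), r * ((1 - Real.exp (f r)) * (1 - Real.exp (g r))))
      = 4 * π * (ν₁ * ν₂ : ℕ)) ∧
    (2 * π * (∫ r in Set.Ioi (0:ℝ), r * (1 - Real.exp (f r)))
      = 4 * π * ((ν₁ * ν₂ + ν₁ : ℕ) : ℝ)) ∧
    (2 * π * (∫ r in Set.Ioi (0:ℝ), r * (1 - Real.exp (g r)))
      = 4 * π * ((ν₁ * ν₂ + ν₂ : ℕ) : ℝ)) := by
  have b1 := fun r => one_sub_exp_bounds (f r) (hn1 r)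
  have b2 := fun r => one_sub_exp_bounds (g r) (hn2 r)
  have q1 : ∀ r : ℝ, 0 < r → 0 ≤ r * (Real.exp (g r) * (1 - Real.exp (f r))) := fun r hr =>
    mul_nonneg hr.le (mul_nonneg (Real.exp_pos _).le (b1 r).1)
  have q2 : ∀ r : ℝ, 0 < r → 0 ≤ r * (Real.exp (f r) * (1 - Real.exp (g r))) := fun r hr =>
    mul_nonneg hr.le (mul_nonneg (Real.exp_pos _).le (b2 r).1)
  have A1 := flux_zero f hd1 _ hP1 q1 _ _ hz1
  have A2 := flux_zero g hd2 _ hP2 q2 _ _ hz2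
  have B1 := flux_top f hd1 _ hP1 q1 ht1
  have B2 := flux_top g hd2 _ hP2 q2 ht2
  obtain ⟨I1, E1⟩ := ftc_pos (fun s => -(s * deriv f s)) _ _ _
    (fun r hr => by simpa only [neg_neg] using (hP1 r hr).fun_neg) q1 A1.neg B1.neg
  obtain ⟨I2, E2⟩ := ftc_pos (fun s => -(s * deriv g s)) _ _ _
    (fun r hr => by simpa only [neg_neg] using (hP2 r hr).fun_neg) q2 A2.neg B2.neg
  have hW0 : Tendsto (fun r : ℝ => r ^ 2 * ((1 - Real.exp (f r)) * (1 - Real.exp (g r))))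
      (𝓝[>] 0) (𝓝 0) := by
    have h : Tendsto (fun r : ℝ => r ^ 2) (𝓝[>] 0) (𝓝 0) := by
      have : Tendsto (fun r : ℝ => r ^ 2) (𝓝 0) (𝓝 (0 ^ 2)) := Continuous.tendsto (by fun_prop) 0
      rw [zero_pow two_ne_zero] at this
      exact this.mono_left nhdsWithin_le_nhds
    refine squeeze_zero (fun r => ?_) (fun r => ?_) h
    · exact mul_nonneg (sq_nonneg r) (mul_nonneg (b1 r).1 (b2 r).1)
    · exact mul_le_of_le_one_right (sq_nonneg r) (mul_le_one₀ (b1 r).2.1 (b2 r).1 (b2 r).2.1)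
  have hW1 : Tendsto (fun r : ℝ => r ^ 2 * ((1 - Real.exp (f r)) * (1 - Real.exp (g r))))
      atTop (𝓝 0) := by
    refine squeeze_zero' ?_ ?_ hsq
    · exact Eventually.of_forall fun r =>
        mul_nonneg (sq_nonneg r) (mul_nonneg (b1 r).1 (b2 r).1)
    · filter_upwards [eventually_ge_atTop 1] with r hr
      refine mul_le_mul_of_nonneg_left ?_ (sq_nonneg r)
      have := mul_le_of_le_one_right (b1 r).1 (b2 r).2.1
      linarith [(b1 r).2.2, hdec r hr, abs_nonneg (g r)]
  obtain ⟨I3, E3⟩ := ftc_pos (fun s => s ^ 2 * ((1 - Real.exp (f s)) * (1 - Real.exp (g s))) -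
      (s * deriv f s) * (s * deriv g s))
    (fun r => 2 * (r * ((1 - Real.exp (f r)) * (1 - Real.exp (g r))))) _ _
    (fun r hr => by
      have h1 := ((hd1 r hr).exp.const_sub 1).fun_mul ((hd2 r hr).exp.const_sub 1)
      have h2 := (((hasDerivAt_id r).fun_pow 2).fun_mul h1).fun_sub ((hP1 r hr).fun_mul (hP2 r hr))
      refine h2.congr_deriv ?_
      simp only [id]
      push_cast
      ring)
    (fun r hr => mul_nonneg zero_le_two (mul_nonneg hr.le (mul_nonneg (b1 r).1 (b2 r).1)))
    (hW0.sub (A1.mul A2)) (hW1.sub (B1.mul B2))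
  have I3' : IntegrableOn (fun r => r * ((1 - Real.exp (f r)) * (1 - Real.exp (g r))))
      (Set.Ioi 0) := by
    refine (I3.const_mul (1/2)).congr (Eventually.of_forall fun r => ?_)
    ring
  rw [integral_const_mul] at E3
  have E4 : ∫ r in Set.Ioi (0:ℝ), r * (1 - Real.exp (f r)) =
      (∫ r in Set.Ioi (0:ℝ), r * (Real.exp (g r) * (1 - Real.exp (f r)))) +
      ∫ r in Set.Ioi (0:ℝ), r * ((1 - Real.exp (f r)) * (1 - Real.exp (g r))) := by
    rw [← integral_add I1 I3']
    congr 1; ext r; ring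
  have E5 : ∫ r in Set.Ioi (0:ℝ), r * (1 - Real.exp (g r)) =
      (∫ r in Set.Ioi (0:ℝ), r * (Real.exp (f r) * (1 - Real.exp (g r)))) +
      ∫ r in Set.Ioi (0:ℝ), r * ((1 - Real.exp (f r)) * (1 - Real.exp (g r))) := by
    rw [← integral_add I2 I3']
    congr 1; ext r; ring
  rw [E4, E5, E1, E2]
  push_cast
  refine ⟨?_, ?_, ?_⟩
  · linear_combination π * E3
  · linear_combination π * E3
  · linear_combination π * E3

theorem stmt19 (ν₁ ν₂ : ℕ) (u₁ u₂ : EuclideanSpace ℝ (Fin 2) → ℝ)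
    (hsm1 : ContDiffOn ℝ (⊤ : ℕ∞) u₁ {(0 : EuclideanSpace ℝ (Fin 2))}ᶜ)
    (hsm2 : ContDiffOn ℝ (⊤ : ℕ∞) u₂ {(0 : EuclideanSpace ℝ (Fin 2))}ᶜ)
    -- radial symmetry
    (hrad1 : ∀ x y : EuclideanSpace ℝ (Fin 2), ‖x‖ = ‖y‖ → u₁ x = u₁ y)
    (hrad2 : ∀ x y : EuclideanSpace ℝ (Fin 2), ‖x‖ = ‖y‖ → u₂ x = u₂ y)
    -- the equations away from the origin
    (heq1 : ∀ x : EuclideanSpace ℝ (Fin 2), x ≠ 0 →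
      lap2 u₁ x + Real.exp (u₂ x) * (1 - Real.exp (u₁ x)) = 0)
    (heq2 : ∀ x : EuclideanSpace ℝ (Fin 2), x ≠ 0 →
      lap2 u₂ x + Real.exp (u₁ x) * (1 - Real.exp (u₂ x)) = 0)
    -- Dirac masses `4πν_i δ₀`: logarithmic singularity of strength `2ν_i` at the origin
    (hsing1 : ∃ c : ℝ, Tendsto (fun x => u₁ x - 2 * (ν₁ : ℝ) * Real.log ‖x‖)
      (𝓝[≠] (0 : EuclideanSpace ℝ (Fin 2))) (𝓝 c))
    (hsing2 : ∃ c : ℝ, Tendsto (fun x => u₂ x - 2 * (ν₂ : ℝ) * Real.log ‖x‖)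
      (𝓝[≠] (0 : EuclideanSpace ℝ (Fin 2))) (𝓝 c))
    (hneg1 : ∀ x, u₁ x ≤ 0) (hneg2 : ∀ x, u₂ x ≤ 0)
    -- exponential decay at infinity (topological solution)
    (hdecay : ∃ C a : ℝ, 0 < a ∧ ∀ x : EuclideanSpace ℝ (Fin 2), 1 ≤ ‖x‖ →
      |u₁ x| + |u₂ x| ≤ C * Real.exp (-a * ‖x‖))
    (hint1 : Integrable (fun x => 1 - Real.exp (u₁ x)))
    (hint2 : Integrable (fun x => 1 - Real.exp (u₂ x))) :
    (∫ x, (1 - Real.exp (u₁ x)) * (1 - Real.exp (u₂ x)) = 4 * π * (ν₁ * ν₂ : ℕ)) ∧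
    (∫ x, (1 - Real.exp (u₁ x)) = 4 * π * ((ν₁ * ν₂ + ν₁ : ℕ) : ℝ)) ∧
    (∫ x, (1 - Real.exp (u₂ x)) = 4 * π * ((ν₁ * ν₂ + ν₂ : ℕ) : ℝ)) := by
  obtain ⟨c₁, hc₁⟩ := hsing1
  obtain ⟨c₂, hc₂⟩ := hsing2
  obtain ⟨C, a, ha, hdec⟩ := hdecay
  have hz1 := prof_sing u₁ _ _ hc₁
  have hz2 := prof_sing u₂ _ _ hc₂
  have hr0 : ∀ r : ℝ, 0 < r → r • (EuclideanSpace.single 0 (1:ℝ) : EuclideanSpace ℝ (Fin 2)) ≠ 0 := by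
    intro r hr; simp [hr.ne']
  have hd1 := fun r hr => (prof_deriv u₁ hsm1 r hr).1
  have hd2 := fun r hr => (prof_deriv u₂ hsm2 r hr).1
  have hl1 := lap_radial u₁ hsm1 hrad1
  have hl2 := lap_radial u₂ hsm2 hrad2
  have hn1 : ∀ r, prof u₁ r ≤ 0 := fun r => hneg1 _
  have hn2 : ∀ r, prof u₂ r ≤ 0 := fun r => hneg2 _
  have hP1 : ∀ r, 0 < r → HasDerivAt (fun s => s * deriv (prof u₁) s)
      (-(r * (Real.exp (prof u₂ r) * (1 - Real.exp (prof u₁ r))))) r := by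
    intro r hr
    convert hl1 r hr using 1
    have := heq1 _ (hr0 r hr)
    unfold prof
    linear_combination (-r) * this
  have hP2 : ∀ r, 0 < r → HasDerivAt (fun s => s * deriv (prof u₂) s)
      (-(r * (Real.exp (prof u₁ r) * (1 - Real.exp (prof u₂ r))))) r := by
    intro r hr
    convert hl2 r hr using 1
    have := heq2 _ (hr0 r hr)
    unfold prof
    linear_combination (-r) * this
  have hdec' : ∀ r : ℝ, 1 ≤ r → |prof u₁ r| + |prof u₂ r| ≤ C * Real.exp (-a * r) := by
    intro r hr
    have := hdec (r • EuclideanSpace.single 0 (1:ℝ)) (by rw [norm_ray r (by linarith)]; exact hr)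
    rwa [norm_ray r (by linarith)] at this
  have hsq := decay_sq a ha C
  have hexp : Tendsto (fun r : ℝ => C * Real.exp (-a * r)) atTop (𝓝 0) := by
    refine squeeze_zero_norm' ?_ (tendsto_zero_iff_norm_tendsto_zero.1 hsq)
    filter_upwards [eventually_ge_atTop 1] with r hr
    rw [norm_mul (r ^ 2)]
    refine le_mul_of_one_le_left (norm_nonneg _) ?_
    rw [Real.norm_of_nonneg (by positivity)]
    nlinarith
  have ht1 : Tendsto (prof u₁) atTop (𝓝 0) := by
    refine squeeze_zero_norm' ?_ hexp
    filter_upwards [eventually_ge_atTop 1] with r hr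
    rw [Real.norm_eq_abs]
    linarith [hdec' r hr, abs_nonneg (prof u₂ r)]
  have ht2 : Tendsto (prof u₂) atTop (𝓝 0) := by
    refine squeeze_zero_norm' ?_ hexp
    filter_upwards [eventually_ge_atTop 1] with r hr
    rw [Real.norm_eq_abs]
    linarith [hdec' r hr, abs_nonneg (prof u₁ r)]
  have hpn1 := prof_norm u₁ hrad1
  have hpn2 := prof_norm u₂ hrad2
  simp only [hpn1, hpn2]
  rw [polar_int (fun r => (1 - Real.exp (prof u₁ r)) * (1 - Real.exp (prof u₂ r))),
    polar_int (fun r => (1 - Real.exp (prof u₁ r))),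
    polar_int (fun r => (1 - Real.exp (prof u₂ r)))]
  clear hl1 hl2 hpn1 hpn2 hint1 hint2 hc₁ hc₂ hdec heq1 heq2 hneg1 hneg2 hrad1 hrad2 hsm1 hsm2
  generalize prof u₁ = f at *
  generalize prof u₂ = g at *
  exact radial_core f g ν₁ ν₂ c₁ c₂ C a hz1 hz2 hd1 hd2 hn1 hn2 hP1 hP2 hdec' hsq ht1 ht2
end
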